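/- arXiv:1207.1145 — 7 statements merged into one kernel-verified Lean document; each statement's English description precedes it below -/
import Mathlib

section
/- Let n ≥ 1, let A be a symmetric positive definite real n×n matrix, let M > 0, and let F : ℝⁿ → ℝⁿ. Suppose there is x̃ ∈ ℝⁿ with ‖x̃‖_{A^{1/2}} < M such that (x − x̃)ᵀ F(x) ≥ 0 for every x ∈ ℝⁿ with ‖x − x̃‖_{A^{1/2}} ≥ 2M. Let a ∈ ℝⁿ satisfy ‖a + A⁻¹ F(a)‖_{A^{1/2}} < M. Then for every λ ∈ [0,1) and every x ∈ ℝⁿ with ‖x‖_{A^{1/2}} ≥ 3M, one has (x − x̃)ᵀ ρ_a(λ, x) > 0; in particular ρ_a(λ, x) ≠ 0. -/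
open Matrix

/-- In an inner product space, points outside a ball of radius `3 * M` see any two points of
the ball of radius `M` under an acute angle. -/
theorem inner_sub_sub_pos_of_norm_lt {E : Type*} [NormedAddCommGroup E] [InnerProductSpace ℝ E]
    {M : ℝ} {x y z : E} (hx : 3 * M ≤ ‖x‖) (hy : ‖y‖ < M) (hz : ‖z‖ < M) :
    0 < inner ℝ (x - y) (x - z) := by
  have hxy : 2 * M < ‖x - y‖ := by linarith [norm_sub_norm_le x y]
  have hyz : ‖y - z‖ < 2 * M := by linarith [norm_sub_le y z]
  have hsplit : inner ℝ (x - y) (x - z) = ‖x - y‖ ^ 2 + inner ℝ (x - y) (y - z) := by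
    rw [← real_inner_self_eq_norm_sq, ← inner_add_right, sub_add_sub_cancel]
  have hcs := neg_le_of_abs_le (abs_real_inner_le_norm (x - y) (y - z))
  nlinarith [norm_nonneg (y - z)]

open scoped MatrixOrder Matrix.Norms.L2Operator in
/-- The bilinear form of a positive semidefinite real matrix is the pullback of the Euclidean
inner product under a linear map. -/
theorem Matrix.PosSemidef.exists_inner_eq_dotProduct_mulVec {ι : Type*} [Fintype ι]
    [DecidableEq ι] {A : Matrix ι ι ℝ} (hA : A.PosSemidef) :
    ∃ L : (ι → ℝ) →ₗ[ℝ] EuclideanSpace ℝ ι, ∀ u v, inner ℝ (L u) (L v) = u ⬝ᵥ A *ᵥ v := by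
  obtain ⟨B, rfl⟩ := CStarAlgebra.nonneg_iff_eq_star_mul_self.mp hA.nonneg
  refine ⟨(WithLp.linearEquiv 2 ℝ (ι → ℝ)).symm.toLinearMap ∘ₗ B.mulVecLin, fun u v => ?_⟩
  rw [star_eq_conjTranspose, conjTranspose_eq_transpose_of_trivial, ← mulVec_mulVec,
    dotProduct_mulVec, vecMul_transpose, dotProduct_comm]
  rfl

theorem stmt_1 (n : ℕ) (hn : 1 ≤ n) (A : Matrix (Fin n) (Fin n) ℝ) (hA : A.PosDef)
    (M : ℝ) (hM : 0 < M) (F : (Fin n → ℝ) → (Fin n → ℝ))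
    (xt : Fin n → ℝ) (hxt : Real.sqrt (xt ⬝ᵥ A.mulVec xt) < M)
    (hF : ∀ x : Fin n → ℝ,
      2 * M ≤ Real.sqrt ((x - xt) ⬝ᵥ A.mulVec (x - xt)) → 0 ≤ (x - xt) ⬝ᵥ F x)
    (a : Fin n → ℝ)
    (ha : Real.sqrt ((a + A⁻¹.mulVec (F a)) ⬝ᵥ A.mulVec (a + A⁻¹.mulVec (F a))) < M)
    (lam : ℝ) (hlam : lam ∈ Set.Ico (0 : ℝ) 1)
    (x : Fin n → ℝ) (hx : 3 * M ≤ Real.sqrt (x ⬝ᵥ A.mulVec x)) :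
    0 < (x - xt) ⬝ᵥ (lam • F x + (1 - lam) • (F x - F a + A.mulVec (x - a))) ∧
      lam • F x + (1 - lam) • (F x - F a + A.mulVec (x - a)) ≠ 0 := by
  suffices h : 0 < (x - xt) ⬝ᵥ (lam • F x + (1 - lam) • (F x - F a + A.mulVec (x - a))) from
    ⟨h, fun h0 => by rw [h0, dotProduct_zero] at h; exact h.false⟩
  obtain ⟨L, hL⟩ := hA.posSemidef.exists_inner_eq_dotProduct_mulVec
  have hnorm (u : Fin n → ℝ) : √(u ⬝ᵥ A *ᵥ u) = ‖L u‖ := by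
    rw [← hL, real_inner_self_eq_norm_sq, Real.sqrt_sq (norm_nonneg _)]
  set b := a + A⁻¹ *ᵥ F a with hb
  rw [hnorm] at hxt ha hx
  have hFx : 0 ≤ (x - xt) ⬝ᵥ F x := by
    refine hF x ?_
    rw [hnorm, map_sub]
    linarith [norm_sub_norm_le (L x) (L xt)]
  have hpos : 0 < (x - xt) ⬝ᵥ A *ᵥ (x - b) := by
    rw [← hL, map_sub, map_sub]
    exact inner_sub_sub_pos_of_norm_lt hx hxt ha
  have hAb : A *ᵥ (x - b) = A *ᵥ (x - a) - F a := by
    rw [hb, ← sub_sub, mulVec_sub, mulVec_mulVec,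
      mul_nonsing_inv _ hA.det_pos.ne'.isUnit, one_mulVec]
  have hrho : lam • F x + (1 - lam) • (F x - F a + A *ᵥ (x - a)) =
      F x + (1 - lam) • A *ᵥ (x - b) := by
    rw [hAb]
    module
  rw [hrho, dotProduct_add, dotProduct_smul, smul_eq_mul]
  exact add_pos_of_nonneg_of_pos hFx (mul_pos (sub_pos.mpr hlam.2) hpos)
end

section
/- Let n ≥ 1, let A be a symmetric positive definite real n×n matrix, let M > 0, and let F : ℝⁿ → ℝⁿ. Suppose there is x̃ ∈ ℝⁿ with ‖x̃‖_{A^{1/2}} < M such that (x − x̃)ᵀ F(x) ≥ 0 for every x ∈ ℝⁿ with ‖x − x̃‖_{A^{1/2}} ≥ 2M, and let a ∈ ℝⁿ satisfy ‖a + A⁻¹ F(a)‖_{A^{1/2}} < M. Then every pair (λ, x) with λ ∈ [0,1) and ρ_a(λ, x) = 0 satisfies ‖x‖_{A^{1/2}} < 3M; consequently the zero set {(λ, x) ∈ [0,1) × ℝⁿ : ρ_a(λ, x) = 0} is a bounded subset of ℝ × ℝⁿ. -/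
open Matrix

open scoped MatrixOrder Matrix.Norms.L2Operator in
/-- A positive definite real matrix is the Gram matrix of an injective linear map into
Euclidean space. -/
theorem Matrix.PosDef.exists_injective_inner_eq {n : ℕ} {A : Matrix (Fin n) (Fin n) ℝ}
    (hA : A.PosDef) :
    ∃ L : (Fin n → ℝ) →ₗ[ℝ] EuclideanSpace ℝ (Fin n),
      Function.Injective L ∧ ∀ u v, inner ℝ (L u) (L v) = u ⬝ᵥ A.mulVec v := by
  obtain ⟨B, hB⟩ :=
    CStarAlgebra.nonneg_iff_eq_star_mul_self.mp hA.posSemidef.nonneg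
  rw [Matrix.star_eq_conjTranspose] at hB
  have inner_eq : ∀ u v, inner ℝ (WithLp.toLp 2 (B.mulVec u)) (WithLp.toLp 2 (B.mulVec v)) =
      u ⬝ᵥ A.mulVec v := by
    intro u v
    rw [EuclideanSpace.inner_toLp_toLp, star_trivial, hB, ← Matrix.mulVec_mulVec,
      Matrix.dotProduct_mulVec u, Matrix.conjTranspose_eq_transpose_of_trivial,
      Matrix.vecMul_transpose, dotProduct_comm]
  refine ⟨(WithLp.linearEquiv 2 ℝ (Fin n → ℝ)).symm.toLinearMap ∘ₗ B.mulVecLin, ?_, inner_eq⟩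
  rw [← LinearMap.ker_eq_bot, LinearMap.ker_eq_bot']
  intro u hu
  by_contra hne
  have hpos := hA.dotProduct_mulVec_pos hne
  have hzero : WithLp.toLp 2 (B.mulVec u) = 0 := hu
  rw [star_trivial, ← inner_eq, hzero, inner_zero_left] at hpos
  exact lt_irrefl _ hpos

/-- If `y` and `w` lie in the open ball of radius `M` around the origin, then so does `x` in the
one of radius `3 * M`, unless `x - y` is long and makes an acute angle with `x - w`. -/
theorem norm_lt_of_inner_sub_sub_nonpos {E : Type*} [NormedAddCommGroup E]
    [InnerProductSpace ℝ E] {M : ℝ} {x y w : E} (hy : ‖y‖ < M) (hw : ‖w‖ < M)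
    (h : 2 * M ≤ ‖x - y‖ → inner ℝ (x - y) (x - w) ≤ 0) : ‖x‖ < 3 * M := by
  by_contra! hx
  have hxy : 2 * M ≤ ‖x - y‖ := by linarith [norm_sub_norm_le x y]
  have hwy : ‖w - y‖ < 2 * M := by linarith [norm_sub_le w y]
  have hsplit : inner ℝ (x - y) (x - w) + inner ℝ (x - y) (w - y) = ‖x - y‖ ^ 2 := by
    rw [← inner_add_right, sub_add_sub_cancel, real_inner_self_eq_norm_sq]
  have hcs := real_inner_le_norm (x - y) (w - y)
  nlinarith [h hxy, norm_nonneg y]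

theorem stmt_2 (n : ℕ) (hn : 1 ≤ n) (A : Matrix (Fin n) (Fin n) ℝ) (hA : A.PosDef)
    (M : ℝ) (hM : 0 < M) (F : (Fin n → ℝ) → (Fin n → ℝ))
    (xt : Fin n → ℝ) (hxt : Real.sqrt (xt ⬝ᵥ A.mulVec xt) < M)
    (hF : ∀ x : Fin n → ℝ,
      2 * M ≤ Real.sqrt ((x - xt) ⬝ᵥ A.mulVec (x - xt)) → 0 ≤ (x - xt) ⬝ᵥ F x)
    (a : Fin n → ℝ)
    (ha : Real.sqrt ((a + A⁻¹.mulVec (F a)) ⬝ᵥ A.mulVec (a + A⁻¹.mulVec (F a))) < M) :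
    (∀ lam ∈ Set.Ico (0 : ℝ) 1, ∀ x : Fin n → ℝ,
        lam • F x + (1 - lam) • (F x - F a + A.mulVec (x - a)) = 0 →
        Real.sqrt (x ⬝ᵥ A.mulVec x) < 3 * M) ∧
      Bornology.IsBounded {p : ℝ × (Fin n → ℝ) | p.1 ∈ Set.Ico (0 : ℝ) 1 ∧
        p.1 • F p.2 + (1 - p.1) • (F p.2 - F a + A.mulVec (p.2 - a)) = 0} := by
  obtain ⟨L, hL, inner_eq⟩ := hA.exists_injective_inner_eq
  have norm_eq : ∀ u, Real.sqrt (u ⬝ᵥ A.mulVec u) = ‖L u‖ := fun u => by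
    rw [← inner_eq, real_inner_self_eq_norm_sq, Real.sqrt_sq (norm_nonneg _)]
  simp only [norm_eq] at hxt hF ha ⊢
  have zero_bound : ∀ lam ∈ Set.Ico (0 : ℝ) 1, ∀ x : Fin n → ℝ,
      lam • F x + (1 - lam) • (F x - F a + A.mulVec (x - a)) = 0 → ‖L x‖ < 3 * M := by
    intro lam hlam x hx
    refine norm_lt_of_inner_sub_sub_nonpos hxt ha fun h => ?_
    rw [← map_sub] at h ⊢
    rw [← map_sub, inner_eq]
    have hdet : IsUnit A.det := hA.det_pos.ne'.isUnit
    have hzero : F x + (1 - lam) • A.mulVec (x - (a + A⁻¹.mulVec (F a))) = 0 := by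
      rw [← hx, ← sub_sub, Matrix.mulVec_sub A (x - a), Matrix.mulVec_mulVec,
        Matrix.mul_nonsing_inv A hdet, Matrix.one_mulVec]
      module
    have hdot := congrArg (fun v => (x - xt) ⬝ᵥ v) hzero
    simp only [dotProduct_add, dotProduct_smul, dotProduct_zero, smul_eq_mul] at hdot
    have hF' := hF x h
    by_contra! hpos
    nlinarith [mul_pos (sub_pos.mpr hlam.2) hpos]
  refine ⟨zero_bound, ?_⟩
  obtain ⟨K, -, hK⟩ := L.exists_antilipschitzWith (LinearMap.ker_eq_bot.mpr hL)
  refine ((Metric.isBounded_Ico (0 : ℝ) 1).prod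
    (hK.isBounded_preimage (Metric.isBounded_ball (x := 0) (r := 3 * M)))).subset ?_
  rintro ⟨lam, x⟩ ⟨hlam, hx⟩
  exact ⟨hlam, mem_ball_zero_iff.mpr (zero_bound lam hlam x hx)⟩
end

section
/- Let n ≥ 1, let A be a symmetric positive definite real n×n matrix, let M > 0, and let F : ℝⁿ → ℝⁿ. Suppose the solution set of F(x) = 0 is nonempty, every solution x̃ satisfies ‖x̃‖_{A^{1/2}} < M, and F is pseudo-monotone at each solution. Let a ∈ ℝⁿ satisfy ‖a + A⁻¹ F(a)‖_{A^{1/2}} < M. Then every pair (λ, x) with λ ∈ [0,1) and ρ_a(λ, x) = 0 satisfies ‖x‖_{A^{1/2}} < 3M. -/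
open Matrix

/-- If `⟪x - t, x - b⟫_A ≤ 0` then `‖x‖_A² ≤ ‖t‖_A² + ‖b‖_A²`. -/
theorem Matrix.PosSemidef.dotProduct_mulVec_le_add {ι : Type*} [Fintype ι]
    {A : Matrix ι ι ℝ} (hA : A.PosSemidef) (x t b : ι → ℝ)
    (h : (x - t) ⬝ᵥ A.mulVec (x - b) ≤ 0) :
    x ⬝ᵥ A.mulVec x ≤ t ⬝ᵥ A.mulVec t + b ⬝ᵥ A.mulVec b := by
  have hsymm (u v : ι → ℝ) : u ⬝ᵥ A.mulVec v = v ⬝ᵥ A.mulVec u := by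
    have hT : Aᵀ = A := by simpa using hA.isHermitian.eq
    rw [dotProduct_mulVec, dotProduct_comm, ← mulVec_transpose, hT]
  have hpos : 0 ≤ (x - t - b) ⬝ᵥ A.mulVec (x - t - b) := by
    simpa using hA.dotProduct_mulVec_nonneg (x - t - b)
  simp only [mulVec_sub, dotProduct_sub, sub_dotProduct] at h hpos
  linarith [hsymm x t, hsymm x b, hsymm t b]

theorem stmt_5 (n : ℕ) (hn : 1 ≤ n) (A : Matrix (Fin n) (Fin n) ℝ) (hA : A.PosDef)
    (M : ℝ) (hM : 0 < M) (F : (Fin n → ℝ) → (Fin n → ℝ))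
    (hne : ∃ x : Fin n → ℝ, F x = 0)
    (hbd : ∀ xt : Fin n → ℝ, F xt = 0 → Real.sqrt (xt ⬝ᵥ A.mulVec xt) < M)
    (hpm : ∀ xt : Fin n → ℝ, F xt = 0 →
      (∀ x : Fin n → ℝ, 0 ≤ (x - xt) ⬝ᵥ F xt) →
      (∀ x : Fin n → ℝ, 0 ≤ (x - xt) ⬝ᵥ F x))
    (a : Fin n → ℝ)
    (ha : Real.sqrt ((a + A⁻¹.mulVec (F a)) ⬝ᵥ A.mulVec (a + A⁻¹.mulVec (F a))) < M) :
    ∀ lam ∈ Set.Ico (0 : ℝ) 1, ∀ x : Fin n → ℝ,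
      lam • F x + (1 - lam) • (F x - F a + A.mulVec (x - a)) = 0 →
      Real.sqrt (x ⬝ᵥ A.mulVec x) < 3 * M := by 
  intro lam hlam x hx
  obtain ⟨t, ht⟩ := hne
  set b := a + A⁻¹.mulVec (F a) with hb
  have hmono : 0 ≤ (x - t) ⬝ᵥ F x := hpm t ht (fun y => by simp [ht]) x
  have hAb : A.mulVec b = A.mulVec a + F a := by
    rw [hb, mulVec_add, mulVec_mulVec, mul_nonsing_inv _ hA.det_pos.ne'.isUnit, one_mulVec]
  have hzero : F x + (1 - lam) • A.mulVec (x - b) = 0 := by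
    rw [← hx, mulVec_sub, mulVec_sub, hAb]
    module
  have hdot := congrArg (fun v => (x - t) ⬝ᵥ v) hzero
  simp only [dotProduct_add, dotProduct_smul, dotProduct_zero, smul_eq_mul] at hdot
  have hle : (x - t) ⬝ᵥ A.mulVec (x - b) ≤ 0 := by
    have := hlam.2
    by_contra! hc
    nlinarith [mul_pos (sub_pos.2 this) hc]
  have hq := hA.posSemidef.dotProduct_mulVec_le_add x t b hle
  have htM := (Real.sqrt_lt' hM).1 (hbd t ht)
  have hbM := (Real.sqrt_lt' hM).1 ha
  rw [Real.sqrt_lt' (by positivity)]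
  nlinarith [sq_nonneg M]
end

section
/- Let n ≥ 1 and μ > 0. For all x, y ∈ ℝⁿ, the Euclidean norm satisfies ‖Φ_μ(x, y) − Φ(x, y)‖ ≤ 2μ√n. -/
/-- The smoothing error of `|t|` by `√(t² + 4μ²)` is at most `2μ`, in squared form. -/
theorem sq_abs_sub_sqrt_sq_add_le {μ : ℝ} (hμ : 0 ≤ μ) (t : ℝ) :
    (|t| - Real.sqrt (t ^ 2 + 4 * μ ^ 2)) ^ 2 ≤ (2 * μ) ^ 2 := by
  have hlower : |t| ≤ Real.sqrt (t ^ 2 + 4 * μ ^ 2) :=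
    Real.abs_le_sqrt (by nlinarith [sq_nonneg μ])
  have hupper : Real.sqrt (t ^ 2 + 4 * μ ^ 2) ≤ |t| + 2 * μ := by
    rw [Real.sqrt_le_left (by positivity)]
    nlinarith [sq_abs t, mul_nonneg (abs_nonneg t) hμ]
  exact sq_le_sq' (by linarith) (by linarith)

theorem stmt_7 (n : ℕ) (hn : 1 ≤ n) (μ : ℝ) (hμ : 0 < μ) (x y : Fin n → ℝ) :
    Real.sqrt (∑ i, ((x i + y i - Real.sqrt ((x i - y i) ^ 2 + 4 * μ ^ 2)) -
        (x i + y i - |x i - y i|)) ^ 2) ≤ 2 * μ * Real.sqrt n := by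
  have hsum : ∑ i, ((x i + y i - Real.sqrt ((x i - y i) ^ 2 + 4 * μ ^ 2)) -
      (x i + y i - |x i - y i|)) ^ 2 ≤ n * (2 * μ) ^ 2 := by
    calc _ ≤ ∑ _i : Fin n, (2 * μ) ^ 2 := Finset.sum_le_sum fun i _ => by
          rw [sub_sub_sub_cancel_left]
          exact sq_abs_sub_sqrt_sq_add_le hμ.le _
      _ = n * (2 * μ) ^ 2 := by simp
  rw [Real.sqrt_le_left (by positivity), mul_pow, Real.sq_sqrt n.cast_nonneg, mul_comm _ (n : ℝ)]
  exact hsum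
end

section
/- For all real numbers a, b, μ, d: φ_μ(a, b) = d if and only if a − d/2 ≥ 0, b − d/2 ≥ 0, and (a − d/2)(b − d/2) = μ², where φ_μ(a, b) := a + b − √((a − b)² + 4μ²). -/
theorem stmt_8 (a b μ d : ℝ) :
    a + b - Real.sqrt ((a - b) ^ 2 + 4 * μ ^ 2) = d ↔
      (0 ≤ a - d / 2 ∧ 0 ≤ b - d / 2 ∧ (a - d / 2) * (b - d / 2) = μ ^ 2) := by
  constructor
  · intro h
    have habs : |a - b| ≤ Real.sqrt ((a - b) ^ 2 + 4 * μ ^ 2) :=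
      Real.abs_le_sqrt (by linarith [sq_nonneg μ])
    have hsq : Real.sqrt ((a - b) ^ 2 + 4 * μ ^ 2) ^ 2 = (a - b) ^ 2 + 4 * μ ^ 2 :=
      Real.sq_sqrt (by positivity)
    have hs : Real.sqrt ((a - b) ^ 2 + 4 * μ ^ 2) = a + b - d := by linarith
    rw [hs] at habs hsq
    obtain ⟨hl, hr⟩ := abs_le.mp habs
    exact ⟨by linarith, by linarith, by linear_combination hsq / 4⟩
  · rintro ⟨ha, hb, hab⟩
    have hs : (a - b) ^ 2 + 4 * μ ^ 2 = (a + b - d) ^ 2 := by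
      linear_combination -4 * hab
    rw [hs, Real.sqrt_sq (by linarith)]
    ring
end

section
/- Let n ≥ 1, f : ℝⁿ → ℝⁿ, β > 0, c > 0, λ ∈ [0,1) and μ := β(1 − λ). Let a = (a′, a″) ∈ ℝⁿ × ℝⁿ with a′_i ≥ β and a″_i ≥ β for every i. If z = (x, y) ∈ ℝⁿ × ℝⁿ satisfies ρ_a(λ, z) = 0, where ρ_a(λ, z) := λ F^μ(z) + (1 − λ)(F^μ(z) − F^μ(a) + c(z − a)), then y_i > 0 for every i = 1, …, n. -/
/-- The smoothed min NCP function `φ_μ(a,b) = a + b - √((a-b)² + 4μ²)`. -/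
noncomputable def phiMu (μ a b : ℝ) : ℝ := a + b - Real.sqrt ((a - b) ^ 2 + 4 * μ ^ 2)

/-- The regularized smoothing map `F^μ(x,y) = (f(x) - y + μx, Φ_μ(x,y) + μy)`. -/
noncomputable def FMu (n : ℕ) (f : (Fin n → ℝ) → (Fin n → ℝ)) (μ : ℝ)
    (z : (Fin n → ℝ) × (Fin n → ℝ)) : (Fin n → ℝ) × (Fin n → ℝ) :=
  (f z.1 - z.2 + μ • z.1, (fun i => phiMu μ (z.1 i) (z.2 i)) + μ • z.2)

theorem phiMu_le_two_mul_right (μ a b : ℝ) : phiMu μ a b ≤ 2 * b := by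
  have h : a - b ≤ Real.sqrt ((a - b) ^ 2 + 4 * μ ^ 2) :=
    Real.le_sqrt_of_sq_le (by nlinarith [sq_nonneg μ])
  unfold phiMu
  linarith

theorem phiMu_nonneg {μ a b : ℝ} (hab : 0 ≤ a + b) (h : μ ^ 2 ≤ a * b) : 0 ≤ phiMu μ a b := by
  have h' : Real.sqrt ((a - b) ^ 2 + 4 * μ ^ 2) ≤ a + b :=
    Real.sqrt_le_iff.mpr ⟨hab, by nlinarith⟩
  unfold phiMu
  linarith

theorem stmt_13 (n : ℕ) (hn : 1 ≤ n) (f : (Fin n → ℝ) → (Fin n → ℝ))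
    (β c lam : ℝ) (hβ : 0 < β) (hc : 0 < c) (hlam : lam ∈ Set.Ico (0 : ℝ) 1)
    (a' a'' : Fin n → ℝ) (ha' : ∀ i, β ≤ a' i) (ha'' : ∀ i, β ≤ a'' i)
    (x y : Fin n → ℝ)
    (hρ : lam • FMu n f (β * (1 - lam)) (x, y) +
        (1 - lam) • (FMu n f (β * (1 - lam)) (x, y) - FMu n f (β * (1 - lam)) (a', a'') +
          c • ((x, y) - (a', a''))) = 0) :
    ∀ i, 0 < y i := by
  obtain ⟨hlam0, hlam1⟩ := hlam
  intro i
  have hμ : 0 < β * (1 - lam) := mul_pos hβ (sub_pos.mpr hlam1)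
  have hμβ : β * (1 - lam) ≤ β := by nlinarith
  have heq := congrFun (congrArg Prod.snd hρ) i
  simp only [FMu, Prod.snd_add, Prod.smul_snd, Prod.snd_sub, Pi.add_apply, Pi.smul_apply,
    Pi.sub_apply, smul_eq_mul, Prod.snd_zero, Pi.zero_apply] at heq
  have ha'i := ha' i
  have ha''i := ha'' i
  have ha : 0 ≤ phiMu (β * (1 - lam)) (a' i) (a'' i) :=
    phiMu_nonneg (by linarith) (by
      rw [sq]
      exact mul_le_mul (hμβ.trans ha'i) (hμβ.trans ha''i) hμ.le (by linarith))
  have hxy := phiMu_le_two_mul_right (β * (1 - lam)) (x i) (y i)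
  generalize β * (1 - lam) = μ at *
  have hright : 0 < (1 - lam) * (phiMu μ (a' i) (a'' i) + (μ + c) * a'' i) := by
    have : 0 < a'' i := by linarith
    have : 0 < 1 - lam := by linarith
    positivity
  have hcoef : 0 < μ + (1 - lam) * c := add_pos hμ (mul_pos (by linarith) hc)
  by_contra! hy
  have hleft := mul_nonpos_of_nonneg_of_nonpos hcoef.le hy
  linarith
end

section
/- Let n ≥ 1, f : ℝⁿ → ℝⁿ and μ ≥ 0. For all z = (x, y) and z̃ = (x̃, ỹ) in ℝⁿ × ℝⁿ, with the Euclidean inner product and norm on ℝ²ⁿ, one has (z − z̃)ᵀ F^μ(z) ≥ (z − z̃)ᵀ F(z) + μ ‖z − z̃‖ (‖z − z̃‖ − ‖z̃‖ − 2√n). -/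
open Matrix

/-- The min NCP function `φ(a,b) = a + b - |a - b|`. -/
def phiMin (a b : ℝ) : ℝ := a + b - |a - b|

/-- The nonsmooth reformulation `F(x,y) = (f(x) - y, Φ(x,y))`. -/
def FNcp (n : ℕ) (f : (Fin n → ℝ) → (Fin n → ℝ))
    (z : (Fin n → ℝ) × (Fin n → ℝ)) : (Fin n → ℝ) × (Fin n → ℝ) :=
  (f z.1 - z.2, fun i => phiMin (z.1 i) (z.2 i))

/-- The Euclidean inner product on `ℝⁿ × ℝⁿ ≅ ℝ²ⁿ`. -/
def pdot (n : ℕ) (z w : (Fin n → ℝ) × (Fin n → ℝ)) : ℝ := z.1 ⬝ᵥ w.1 + z.2 ⬝ᵥ w.2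

/-- The Euclidean norm on `ℝⁿ × ℝⁿ ≅ ℝ²ⁿ`. -/
noncomputable def enorm (n : ℕ) (z : (Fin n → ℝ) × (Fin n → ℝ)) : ℝ :=
  Real.sqrt (z.1 ⬝ᵥ z.1 + z.2 ⬝ᵥ z.2)

theorem pdot_le_enorm_mul_enorm (n : ℕ) (z w : (Fin n → ℝ) × (Fin n → ℝ)) :
    pdot n z w ≤ enorm n z * enorm n w := by
  have h := Real.sum_mul_le_sqrt_mul_sqrt (Finset.univ : Finset (Fin n ⊕ Fin n))
    (Sum.elim z.1 z.2) (Sum.elim w.1 w.2)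
  simpa [pdot, _root_.enorm, dotProduct, Fintype.sum_sum_type, pow_two] using h

theorem sqrt_sq_add_le_abs_add {a μ : ℝ} (hμ : 0 ≤ μ) :
    Real.sqrt (a ^ 2 + 4 * μ ^ 2) ≤ |a| + 2 * μ := by
  rw [Real.sqrt_le_left (by positivity)]
  nlinarith [sq_abs a, mul_nonneg (abs_nonneg a) hμ]

theorem abs_le_sqrt_sq_add (a μ : ℝ) : |a| ≤ Real.sqrt (a ^ 2 + 4 * μ ^ 2) :=
  Real.abs_le_sqrt (by nlinarith [sq_nonneg μ])

theorem enorm_zero_prod_le {n : ℕ} {d : Fin n → ℝ} {c : ℝ} (hc : 0 ≤ c)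
    (hd : ∀ i, 0 ≤ d i ∧ d i ≤ c) : enorm n (0, d) ≤ c * Real.sqrt n := by
  rw [_root_.enorm, Real.sqrt_le_left (by positivity), mul_pow, Real.sq_sqrt (Nat.cast_nonneg n)]
  rw [zero_dotProduct, zero_add, dotProduct]
  calc ∑ i, d i * d i ≤ ∑ _i : Fin n, c ^ 2 :=
        Finset.sum_le_sum fun i _ => by nlinarith [hd i]
    _ = c ^ 2 * n := by simp [mul_comm]

theorem stmt_14 (n : ℕ) (hn : 1 ≤ n) (f : (Fin n → ℝ) → (Fin n → ℝ)) (μ : ℝ) (hμ : 0 ≤ μ)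
    (z zt : (Fin n → ℝ) × (Fin n → ℝ)) :
    pdot n (z - zt) (FNcp n f z) +
        μ * enorm n (z - zt) * (enorm n (z - zt) - enorm n zt - 2 * Real.sqrt n) ≤
      pdot n (z - zt) (FMu n f μ z) := by
  set w := z - zt with hw
  let d : Fin n → ℝ := fun i => phiMin (z.1 i) (z.2 i) - phiMu μ (z.1 i) (z.2 i)
  have hd : ∀ i, 0 ≤ d i ∧ d i ≤ 2 * μ := fun i => by
    have h₁ := abs_le_sqrt_sq_add (z.1 i - z.2 i) μ
    have h₂ := sqrt_sq_add_le_abs_add (a := z.1 i - z.2 i) hμ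
    simp only [d, phiMin, phiMu]
    constructor <;> linarith
  have h_w : 0 ≤ enorm n w := Real.sqrt_nonneg _
  have h_smoothing : pdot n w (0, d) ≤ enorm n w * (2 * μ * Real.sqrt n) :=
    (pdot_le_enorm_mul_enorm n w (0, d)).trans
      (mul_le_mul_of_nonneg_left (enorm_zero_prod_le (by positivity) hd) h_w)
  have h_reg : pdot n w (-zt) ≤ enorm n w * enorm n zt := by
    simpa [_root_.enorm] using pdot_le_enorm_mul_enorm n w (-zt)
  have h_sq : enorm n w * enorm n w = pdot n w w :=
    Real.mul_self_sqrt (add_nonneg (Finset.sum_nonneg fun i _ => mul_self_nonneg _)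
      (Finset.sum_nonneg fun i _ => mul_self_nonneg _))
  have h_split : pdot n w (FMu n f μ z) =
      pdot n w (FNcp n f z) - pdot n w (0, d) + μ * (pdot n w w - pdot n w (-zt)) := by
    have hz : z = w + zt := by simp [hw]
    have h_phi : (fun i => phiMu μ (z.1 i) (z.2 i)) =
        (fun i => phiMin (z.1 i) (z.2 i)) - d := by
      ext i; simp [d]
    have h₁ : z.1 = w.1 + zt.1 := congrArg Prod.fst hz
    have h₂ : z.2 = w.2 + zt.2 := congrArg Prod.snd hz
    have h₃ : w.1 ⬝ᵥ z.1 = w.1 ⬝ᵥ w.1 + w.1 ⬝ᵥ zt.1 := by rw [h₁, dotProduct_add]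
    have h₄ : w.2 ⬝ᵥ z.2 = w.2 ⬝ᵥ w.2 + w.2 ⬝ᵥ zt.2 := by rw [h₂, dotProduct_add]
    simp only [pdot, FMu, FNcp, h_phi, dotProduct_add, dotProduct_sub, dotProduct_smul,
      dotProduct_zero, Prod.fst_neg, Prod.snd_neg, dotProduct_neg, smul_eq_mul, h₃, h₄]
    ring
  rw [h_split, ← h_sq]
  nlinarith [mul_le_mul_of_nonneg_left h_reg hμ]
end
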